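/- (Representation "A".) Let ρ > 1/2, ϵ > 0, and let δ₁, δ₂ be real numbers with π/(2ρ) < δ₁ ≤ min(π, π/ρ) and π/(2ρ) < δ₂ ≤ min(π, π/ρ). Let μ ∈ ℂ and let z = R·exp(iθ) with R > 0 and π/(2ρ) − δ₂ + π < θ < −π/(2ρ) + δ₁ + π. Then E_{ρ,μ}(z) = ∫_{1+ϵ}^{∞} K_{ρ,μ}(r, −δ₁, δ₂, z) dr + ∫_{−δ₁−π}^{δ₂−π} P_{ρ,μ}(1+ϵ, φ, z) dφ. -/

import Mathlib

open scoped Real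
open MeasureTheory intervalIntegral

/-- The two-parameter Mittag-Leffler function
`E_{ρ,μ}(z) = ∑_{k=0}^∞ z^k / Γ(μ + k/ρ)`. -/
noncomputable def ML (ρ : ℝ) (μ z : ℂ) : ℂ :=
  ∑' k : ℕ, z ^ k * (Complex.Gamma (μ + (k : ℂ) / (ρ : ℂ)))⁻¹

/-- `φ_{ρ,μ}(ζ,z) = (ρ/(2πi)) exp((ζz)^ρ) (ζz)^{ρ(1-μ)}` at `ζ = r e^{iφ}`,
on the branch fixed by `arg z = θ`, `z = R e^{iθ}`. -/
noncomputable def phiFun (ρ : ℝ) (μ : ℂ) (R θ r φ : ℝ) : ℂ :=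
  ((ρ : ℂ) / (2 * (π : ℂ) * Complex.I)) *
    Complex.exp (Complex.exp ((ρ : ℂ) * ((Real.log (R * r) : ℂ) + Complex.I * ((θ + φ : ℝ) : ℂ)))) *
    Complex.exp ((ρ : ℂ) * (1 - μ) * ((Real.log (R * r) : ℂ) + Complex.I * ((θ + φ : ℝ) : ℂ)))

/-- The (complex-valued) phase function `η(r,φ)`. -/
noncomputable def etaF (ρ : ℝ) (μ : ℂ) (R θ r φ : ℝ) : ℂ :=
  Complex.exp ((ρ : ℂ) * ((Real.log (R * r) : ℂ) + Complex.I * ((θ - π : ℝ) : ℂ))) *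
      Complex.sin ((ρ : ℂ) * (φ : ℂ)) +
    (ρ : ℂ) * (1 - μ) * (φ : ℂ)

/-- The function `A_{ρ,μ}(r,ω₁,ω₂,z)`. -/
noncomputable def AF (ρ : ℝ) (μ : ℂ) (R θ r ω₁ ω₂ : ℝ) : ℂ :=
  Complex.exp (Complex.exp ((ρ : ℂ) * ((Real.log (R * r) : ℂ) + Complex.I * ((θ - π : ℝ) : ℂ))) *
      Complex.cos ((ρ : ℂ) * (ω₁ : ℂ))) *
    ((r ^ 2 + 2 * r * Real.cos ω₂ + 1 : ℝ) : ℂ) *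
    Complex.exp (Complex.I * etaF ρ μ R θ r ω₁) *
    ((r : ℂ) + Complex.exp (Complex.I * (ω₁ : ℂ)))

/-- The kernel `K_{ρ,μ}(r,φ₁,φ₂,z)`. -/
noncomputable def KF (ρ : ℝ) (μ : ℂ) (R θ r φ₁ φ₂ : ℝ) : ℂ :=
  ((ρ : ℂ) / (2 * (π : ℂ) * Complex.I)) *
    Complex.exp ((ρ : ℂ) * (1 - μ) * ((Real.log (R * r) : ℂ) + Complex.I * (θ : ℂ))) *
    Complex.exp (-(Complex.I * (ρ : ℂ) * (π : ℂ) * (1 - μ))) *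
    (AF ρ μ R θ r φ₂ φ₁ - AF ρ μ R θ r φ₁ φ₂) /
    (((r ^ 2 + 2 * r * Real.cos φ₁ + 1 : ℝ) : ℂ) * ((r ^ 2 + 2 * r * Real.cos φ₂ + 1 : ℝ) : ℂ))

/-- The (complex-valued) phase function `χ(r,φ)`. -/
noncomputable def chiF (ρ : ℝ) (μ : ℂ) (R θ r φ : ℝ) : ℂ :=
  Complex.exp ((ρ : ℂ) * ((Real.log (R * r) : ℂ) + Complex.I * (θ : ℂ))) *
      Complex.sin ((ρ : ℂ) * (φ : ℂ)) +
    (ρ : ℂ) * (1 - μ) * (φ : ℂ)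

/-- The kernel `P_{ρ,μ}(r,φ,z)`. -/
noncomputable def PF (ρ : ℝ) (μ : ℂ) (R θ r φ : ℝ) : ℂ :=
  ((ρ : ℂ) / (2 * (π : ℂ))) *
    Complex.exp (Complex.exp ((ρ : ℂ) * ((Real.log (R * r) : ℂ) + Complex.I * (θ : ℂ))) *
      Complex.cos ((ρ : ℂ) * (φ : ℂ))) *
    Complex.exp ((ρ : ℂ) * (1 - μ) * ((Real.log (R * r) : ℂ) + Complex.I * (θ : ℂ))) *
    Complex.exp (Complex.I * chiF ρ μ R θ r φ) *
    ((r : ℂ) * ((r : ℂ) - Complex.exp (Complex.I * (φ : ℂ)))) /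
    ((r ^ 2 - 2 * r * Real.cos φ + 1 : ℝ) : ℂ)

/-- The symmetric kernel `K_{ρ,μ}(r,φ,z)` (case `δ₁ρ = δ₂ρ`). -/
noncomputable def KsymF (ρ : ℝ) (μ : ℂ) (R θ r φ : ℝ) : ℂ :=
  ((ρ : ℂ) / (π : ℂ)) *
    Complex.exp ((ρ : ℂ) * (1 - μ) * ((Real.log (R * r) : ℂ) + Complex.I * ((θ - π : ℝ) : ℂ))) *
    Complex.exp (Complex.exp ((ρ : ℂ) * ((Real.log (R * r) : ℂ) + Complex.I * ((θ - π : ℝ) : ℂ))) *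
      Complex.cos ((ρ : ℂ) * (φ : ℂ))) *
    ((r : ℂ) * Complex.sin (etaF ρ μ R θ r φ) + Complex.sin (etaF ρ μ R θ r φ + (φ : ℂ))) /
    ((r ^ 2 + 2 * r * Real.cos φ + 1 : ℝ) : ℂ)

/-- The kernel `K_{ρ,μ}(r,z)` (case `δρ = π/ρ`). -/
noncomputable def KpiF (ρ : ℝ) (μ : ℂ) (R θ r : ℝ) : ℂ :=
  ((ρ : ℂ) / (π : ℂ)) *
    Complex.exp ((ρ : ℂ) * (1 - μ) * ((Real.log (R * r) : ℂ) + Complex.I * ((θ - π : ℝ) : ℂ))) *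
    Complex.exp (-Complex.exp ((ρ : ℂ) * ((Real.log (R * r) : ℂ) + Complex.I * ((θ - π : ℝ) : ℂ)))) *
    ((r : ℂ) * Complex.sin ((π : ℂ) * (1 - μ)) +
      Complex.sin ((π : ℂ) * (1 - μ) + (π : ℂ) / (ρ : ℂ))) /
    ((r ^ 2 + 2 * r * Real.cos (π / ρ) + 1 : ℝ) : ℂ)

/-- The kernel `K′_{ρ,μ}(r,φ,z)`. -/
noncomputable def KpF (ρ : ℝ) (μ : ℂ) (R θ r φ : ℝ) : ℂ :=
  ((ρ : ℂ) / (2 * (π : ℂ) * Complex.I)) *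
    Complex.exp (Complex.exp ((ρ : ℂ) * ((Real.log (R * r) : ℂ) + Complex.I * ((θ - π : ℝ) : ℂ))) *
      Complex.cos ((ρ : ℂ) * (φ : ℂ))) *
    Complex.exp ((ρ : ℂ) * (1 - μ) * ((Real.log (R * r) : ℂ) + Complex.I * (θ : ℂ))) *
    Complex.exp (Complex.I * (etaF ρ μ R θ r φ - (π : ℂ) * (ρ : ℂ) * (1 - μ))) *
    ((r : ℂ) + Complex.exp (Complex.I * (φ : ℂ))) /
    ((r ^ 2 + 2 * r * Real.cos φ + 1 : ℝ) : ℂ)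

/-- `r(τ,ψ) = √(τ² + 2τ cos ψ + 1)`. -/
noncomputable def rP (τ ψ : ℝ) : ℝ := Real.sqrt (τ ^ 2 + 2 * τ * Real.cos ψ + 1)

/-- `φ(τ,ψ,k) = arctan(τ sin ψ / (τ cos ψ + 1)) + kπ`. -/
noncomputable def phiP (τ ψ : ℝ) (k : ℤ) : ℝ :=
  Real.arctan (τ * Real.sin ψ / (τ * Real.cos ψ + 1)) + k * π

/-- The (complex-valued) phase `χ′(τ,ψ,k,z)`. -/
noncomputable def chiP (ρ : ℝ) (μ : ℂ) (R θ τ ψ : ℝ) (k : ℤ) : ℂ :=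
  Complex.exp ((ρ : ℂ) * ((Real.log (R * rP τ ψ) : ℂ) + Complex.I * (θ : ℂ))) *
      Complex.sin ((ρ : ℂ) * (phiP τ ψ k : ℂ)) +
    (ρ : ℂ) * (1 - μ) * (phiP τ ψ k : ℂ)

/-- The kernel `P′_{ρ,μ}(τ,ψ,k,z)`. -/
noncomputable def PpF (ρ : ℝ) (μ : ℂ) (R θ τ ψ : ℝ) (k : ℤ) : ℂ :=
  ((ρ * τ : ℝ) : ℂ) / (2 * (π : ℂ)) *
    Complex.exp (Complex.exp ((ρ : ℂ) * ((Real.log (R * rP τ ψ) : ℂ) + Complex.I * (θ : ℂ))) *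
      Complex.cos ((ρ : ℂ) * (phiP τ ψ k : ℂ))) *
    Complex.exp ((ρ : ℂ) * (1 - μ) * ((Real.log (R * rP τ ψ) : ℂ) + Complex.I * (θ : ℂ))) *
    Complex.exp (Complex.I * (chiP ρ μ R θ τ ψ k + (ψ : ℂ))) *
    ((rP τ ψ : ℂ) * Complex.exp (-(Complex.I * (phiP τ ψ k : ℂ))) - 1) /
    ((rP τ ψ ^ 2 - 2 * rP τ ψ * Real.cos (phiP τ ψ k) + 1 : ℝ) : ℂ)

/-- The Hankel integrand `e^t t^{-s} dt` in the coordinate `t = e^u`. -/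
noncomputable def hankelIntegrand (s u : ℂ) : ℂ :=
  Complex.exp (Complex.exp u + (1 - s) * u)

/-- The Hankel integral in the logarithmic coordinate: in along `Im u = α`, up the segment
`Re u = a`, out along `Im u = β`. -/
noncomputable def hankelIntegral (s : ℂ) (a α β : ℝ) : ℂ :=
  Complex.I * (∫ y in α..β, hankelIntegrand s (a + y * Complex.I)) +
    ((∫ x in Set.Ioi a, hankelIntegrand s (x + β * Complex.I)) -
      ∫ x in Set.Ioi a, hankelIntegrand s (x + α * Complex.I))

lemma differentiable_hankelIntegrand (s : ℂ) : Differentiable ℂ (hankelIntegrand s) := by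
  unfold hankelIntegrand; fun_prop

lemma continuous_hankelIntegrand (s : ℂ) : Continuous (hankelIntegrand s) :=
  (differentiable_hankelIntegrand s).continuous

lemma norm_hankelIntegrand (s : ℂ) (x y : ℝ) :
    ‖hankelIntegrand s (x + y * Complex.I)‖ =
      Real.exp (Real.exp x * Real.cos y + (1 - s.re) * x + s.im * y) := by
  rw [hankelIntegrand, Complex.norm_exp]
  congr 1
  simp [Complex.exp_re]
  ring

lemma norm_hankelIntegrand_le {s : ℂ} {x y b M : ℝ} (hy : Real.cos y ≤ -b) (hM : |y| ≤ M) :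
    ‖hankelIntegrand s (x + y * Complex.I)‖ ≤
      Real.exp (|s.im| * M) * Real.exp (-(b * Real.exp x - (1 - s.re) * x)) := by
  rw [norm_hankelIntegrand, ← Real.exp_add]
  have h1 : s.im * y ≤ |s.im| * M := by
    refine (le_abs_self _).trans ?_
    rw [abs_mul]
    gcongr
  have h2 := mul_le_mul_of_nonneg_left hy (Real.exp_pos x).le
  apply Real.exp_le_exp.2
  linarith

lemma tendsto_mul_exp_sub_mul_atTop {b : ℝ} (hb : 0 < b) (p : ℝ) :
    Filter.Tendsto (fun x : ℝ => b * Real.exp x - p * x) Filter.atTop Filter.atTop := by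
  have h := Filter.tendsto_id.atTop_mul_atTop₀ (Filter.tendsto_atTop_add_const_right _ (-p)
    (Real.tendsto_mul_exp_add_div_pow_atTop b 0 1 hb))
  refine h.congr' ?_
  filter_upwards [Filter.eventually_gt_atTop 0] with x hx
  simp only [id]
  field_simp
  ring

lemma integrableOn_hankelIntegrand (s : ℂ) (a : ℝ) {y : ℝ} (hy : Real.cos y < 0) :
    IntegrableOn (fun x : ℝ => hankelIntegrand s (x + y * Complex.I)) (Set.Ioi a) := by
  have hc : Continuous (fun x : ℝ => hankelIntegrand s (x + y * Complex.I)) :=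
    (continuous_hankelIntegrand s).comp (by fun_prop)
  rw [IntegrableOn, ← integrable_norm_iff hc.aestronglyMeasurable]
  refine integrable_of_isBigO_exp_neg (b := 1) one_pos hc.norm.continuousOn
    (Asymptotics.IsBigO.of_bound (Real.exp (|s.im| * |y|)) ?_)
  filter_upwards [(tendsto_mul_exp_sub_mul_atTop (neg_pos.2 hy) (2 - s.re)).eventually_ge_atTop 0]
    with x hx
  rw [norm_norm, Real.norm_of_nonneg (Real.exp_pos _).le]
  refine (norm_hankelIntegrand_le (b := -Real.cos y) (by simp) le_rfl).trans ?_
  gcongr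
  linarith

lemma tendsto_segment_hankelIntegrand_atTop (s : ℂ) {α β b : ℝ} (hb : 0 < b)
    (h : ∀ y ∈ Set.uIcc α β, Real.cos y ≤ -b) :
    Filter.Tendsto (fun x : ℝ => ∫ y in α..β, hankelIntegrand s (x + y * Complex.I))
      Filter.atTop (nhds 0) := by
  have h0 : Filter.Tendsto (fun x : ℝ => Real.exp (|s.im| * (max |α| |β|)) *
      Real.exp (-(b * Real.exp x - (1 - s.re) * x)) * |β - α|) Filter.atTop (nhds 0) := by
    have := ((Real.tendsto_exp_neg_atTop_nhds_zero.comp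
      (tendsto_mul_exp_sub_mul_atTop hb (1 - s.re))).const_mul
      (Real.exp (|s.im| * (max |α| |β|)))).mul_const |β - α|
    simpa using this
  refine squeeze_zero_norm (fun x => ?_) h0
  refine intervalIntegral.norm_integral_le_of_norm_le_const fun y hy => ?_
  refine norm_hankelIntegrand_le (h y (Set.uIoc_subset_uIcc hy)) ?_
  rcases Set.mem_uIcc.1 (Set.uIoc_subset_uIcc hy) with h | h
  · exact abs_le_max_abs_abs h.1 h.2
  · rw [max_comm]; exact abs_le_max_abs_abs h.1 h.2

lemma tendsto_segment_hankelIntegrand_atBot {s : ℂ} (hs : s.re < 1) (α β : ℝ) :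
    Filter.Tendsto (fun x : ℝ => ∫ y in α..β, hankelIntegrand s (x + y * Complex.I))
      Filter.atBot (nhds 0) := by
  have h0 : Filter.Tendsto (fun x : ℝ => Real.exp (|s.im| * (max |α| |β|)) *
      Real.exp (-(-1 * Real.exp x - (1 - s.re) * x)) * |β - α|) Filter.atBot (nhds 0) := by
    have h1 : Filter.Tendsto (fun x : ℝ => -(-1 * Real.exp x - (1 - s.re) * x)) Filter.atBot
        Filter.atBot := by
      have := Real.tendsto_exp_atBot.add_atBot
        (Filter.tendsto_id.const_mul_atBot (sub_pos.2 hs))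
      refine this.congr fun x => ?_
      simp only [id]; ring
    have := ((Real.tendsto_exp_atBot.comp h1).const_mul
      (Real.exp (|s.im| * (max |α| |β|)))).mul_const |β - α|
    simpa using this
  refine squeeze_zero_norm (fun x => ?_) h0
  refine intervalIntegral.norm_integral_le_of_norm_le_const fun y hy => ?_
  refine norm_hankelIntegrand_le (by simpa using Real.cos_le_one y) ?_
  rcases Set.mem_uIcc.1 (Set.uIoc_subset_uIcc hy) with h | h
  · exact abs_le_max_abs_abs h.1 h.2
  · rw [max_comm]; exact abs_le_max_abs_abs h.1 h.2

lemma integral_boundary_rect_of_differentiable {f : ℂ → ℂ} (hf : Differentiable ℂ f)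
    (a b α β : ℝ) :
    (∫ x : ℝ in a..b, f (x + α * Complex.I)) - (∫ x : ℝ in a..b, f (x + β * Complex.I)) +
      Complex.I * (∫ y : ℝ in α..β, f (b + y * Complex.I)) -
      Complex.I * (∫ y : ℝ in α..β, f (a + y * Complex.I)) = 0 := by
  have := Complex.integral_boundary_rect_eq_zero_of_differentiableOn f
    (a + α * Complex.I) (b + β * Complex.I) hf.differentiableOn
  simpa using this

lemma integral_Ioi_sub_integral_Ioi_of_differentiable {f : ℂ → ℂ} (hf : Differentiable ℂ f)
    {a α β : ℝ} (hα : IntegrableOn (fun x : ℝ => f (x + α * Complex.I)) (Set.Ioi a))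
    (hβ : IntegrableOn (fun x : ℝ => f (x + β * Complex.I)) (Set.Ioi a))
    (h : Filter.Tendsto (fun x : ℝ => ∫ y : ℝ in α..β, f (x + y * Complex.I))
      Filter.atTop (nhds 0)) :
    (∫ x : ℝ in Set.Ioi a, f (x + α * Complex.I)) - (∫ x : ℝ in Set.Ioi a, f (x + β * Complex.I))
      = Complex.I * ∫ y : ℝ in α..β, f (a + y * Complex.I) := by
  have h1 := ((intervalIntegral_tendsto_integral_Ioi a hα Filter.tendsto_id).sub
    (intervalIntegral_tendsto_integral_Ioi a hβ Filter.tendsto_id)).add (h.const_mul Complex.I)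
  rw [mul_zero, add_zero] at h1
  refine tendsto_nhds_unique h1 (tendsto_const_nhds.congr fun b => ?_)
  simp only [id]
  linear_combination -integral_boundary_rect_of_differentiable hf a b α β

lemma integral_Iic_sub_integral_Iic_of_differentiable {f : ℂ → ℂ} (hf : Differentiable ℂ f)
    {a α β : ℝ} (hα : IntegrableOn (fun x : ℝ => f (x + α * Complex.I)) (Set.Iic a))
    (hβ : IntegrableOn (fun x : ℝ => f (x + β * Complex.I)) (Set.Iic a))
    (h : Filter.Tendsto (fun x : ℝ => ∫ y : ℝ in α..β, f (x + y * Complex.I))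
      Filter.atBot (nhds 0)) :
    (∫ x : ℝ in Set.Iic a, f (x + β * Complex.I)) - (∫ x : ℝ in Set.Iic a, f (x + α * Complex.I))
      = Complex.I * ∫ y : ℝ in α..β, f (a + y * Complex.I) := by
  have h1 := ((intervalIntegral_tendsto_integral_Iic a hβ Filter.tendsto_id).sub
    (intervalIntegral_tendsto_integral_Iic a hα Filter.tendsto_id)).add (h.const_mul Complex.I)
  rw [mul_zero, add_zero] at h1
  refine tendsto_nhds_unique h1 (tendsto_const_nhds.congr fun b => ?_)
  simp only [id]
  linear_combination integral_boundary_rect_of_differentiable hf b a α β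

lemma exists_pos_forall_cos_le_neg {α β : ℝ} (h : ∀ y ∈ Set.uIcc α β, Real.cos y < 0) :
    ∃ b > 0, ∀ y ∈ Set.uIcc α β, Real.cos y ≤ -b := by
  obtain ⟨y₀, hy₀, hmax⟩ := isCompact_uIcc.exists_isMaxOn (Set.nonempty_uIcc (a := α) (b := β))
    Real.continuous_cos.continuousOn
  exact ⟨-Real.cos y₀, neg_pos.2 (h _ hy₀), fun y hy => by simpa using hmax hy⟩

lemma integral_Ioi_hankelIntegrand_sub (s : ℂ) (a : ℝ) {α β : ℝ}
    (h : ∀ y ∈ Set.uIcc α β, Real.cos y < 0) :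
    (∫ x in Set.Ioi a, hankelIntegrand s (x + α * Complex.I)) -
      (∫ x in Set.Ioi a, hankelIntegrand s (x + β * Complex.I)) =
      Complex.I * ∫ y in α..β, hankelIntegrand s (a + y * Complex.I) := by
  obtain ⟨b, hb, hb'⟩ := exists_pos_forall_cos_le_neg h
  exact integral_Ioi_sub_integral_Ioi_of_differentiable (differentiable_hankelIntegrand s)
    (integrableOn_hankelIntegrand s a (h _ Set.left_mem_uIcc))
    (integrableOn_hankelIntegrand s a (h _ Set.right_mem_uIcc))
    (tendsto_segment_hankelIntegrand_atTop s hb hb')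

lemma intervalIntegrable_hankelIntegrand (s : ℂ) (a α β : ℝ) :
    IntervalIntegrable (fun y : ℝ => hankelIntegrand s (a + y * Complex.I)) volume α β :=
  ((continuous_hankelIntegrand s).comp (by fun_prop)).intervalIntegrable _ _

lemma hankelIntegral_eq_of_cos_neg (s : ℂ) (a : ℝ) {α α' β β' : ℝ}
    (hα : ∀ y ∈ Set.uIcc α α', Real.cos y < 0) (hβ : ∀ y ∈ Set.uIcc β β', Real.cos y < 0) :
    hankelIntegral s a α β = hankelIntegral s a α' β' := by
  have h1 := integral_Ioi_hankelIntegrand_sub s a hα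
  have h2 := integral_Ioi_hankelIntegrand_sub s a hβ
  have h3 := intervalIntegral.integral_add_adjacent_intervals
    (intervalIntegrable_hankelIntegrand s a α α') (intervalIntegrable_hankelIntegrand s a α' β')
  have h4 := intervalIntegral.integral_add_adjacent_intervals
    (intervalIntegrable_hankelIntegrand s a α β) (intervalIntegrable_hankelIntegrand s a β β')
  unfold hankelIntegral
  linear_combination h2 - h1 + Complex.I * (h4 - h3)

lemma hankelIntegrand_add_pi (s : ℂ) (x : ℝ) :
    hankelIntegrand s (x + (π : ℝ) * Complex.I) =
      Complex.exp (π * Complex.I * (1 - s)) * (Complex.exp (-Complex.exp x + (1 - s) * x)) := by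
  rw [hankelIntegrand, ← Complex.exp_add, Complex.exp_add_pi_mul_I]
  congr 1; ring

lemma hankelIntegrand_sub_pi (s : ℂ) (x : ℝ) :
    hankelIntegrand s (x + (-π : ℝ) * Complex.I) =
      Complex.exp (-(π * Complex.I * (1 - s))) *
        (Complex.exp (-Complex.exp x + (1 - s) * x)) := by
  have : (x : ℂ) + (-π : ℝ) * Complex.I = x - π * Complex.I := by push_cast; ring
  rw [hankelIntegrand, ← Complex.exp_add, this, Complex.exp_sub_pi_mul_I]
  congr 1; ring

lemma cexp_ofReal_exp_smul (w : ℂ) (x : ℝ) :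
    |Real.exp x| • ((Real.exp (-Real.exp x) : ℂ) * (Real.exp x : ℂ) ^ (w - 1)) =
      Complex.exp (-Complex.exp x + w * x) := by
  rw [abs_of_pos (Real.exp_pos x), Complex.real_smul, Complex.ofReal_exp, Complex.ofReal_exp,
    Complex.ofReal_neg, Complex.ofReal_exp, Complex.cpow_def_of_ne_zero (Complex.exp_ne_zero _),
    ← Complex.ofReal_exp, ← Complex.ofReal_log (Real.exp_pos x).le, Real.log_exp,
    Complex.ofReal_exp, ← Complex.exp_add, ← Complex.exp_add]
  congr 1; ring

lemma integrable_cexp_neg_exp_add {w : ℂ} (hw : 0 < w.re) :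
    Integrable fun x : ℝ => Complex.exp (-Complex.exp x + w * x) := by
  have h := Complex.GammaIntegral_convergent hw
  rw [← Real.range_exp, ← Set.image_univ,
    integrableOn_image_iff_integrableOn_abs_deriv_smul MeasurableSet.univ
    (fun x _ => (Real.hasDerivAt_exp x).hasDerivWithinAt) Real.exp_injective.injOn] at h
  simp only [cexp_ofReal_exp_smul] at h
  exact integrableOn_univ.1 h

lemma integral_cexp_neg_exp_add {w : ℂ} (hw : 0 < w.re) :
    ∫ x : ℝ, Complex.exp (-Complex.exp x + w * x) = Complex.Gamma w := by
  rw [Complex.Gamma_eq_integral hw, Complex.GammaIntegral, ← Real.range_exp, ← Set.image_univ,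
    integral_image_eq_integral_abs_deriv_smul MeasurableSet.univ
    (fun x _ => (Real.hasDerivAt_exp x).hasDerivWithinAt) Real.exp_injective.injOn]
  simp only [cexp_ofReal_exp_smul, setIntegral_univ]

lemma sin_pi_mul_Gamma_one_sub {s : ℂ} (hs : s.re < 1) :
    Complex.sin (π * s) * Complex.Gamma (1 - s) = π * (Complex.Gamma s)⁻¹ := by
  have h := Complex.Gamma_mul_Gamma_one_sub s
  have hG : Complex.Gamma (1 - s) ≠ 0 := Complex.Gamma_ne_zero_of_re_pos (by simpa using hs)
  have hπ : (π : ℂ) ≠ 0 := by exact_mod_cast Real.pi_ne_zero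
  by_cases h0 : Complex.sin (π * s) = 0
  · rw [h0, div_zero, mul_eq_zero, or_iff_left hG] at h
    simp [h0, h]
  · have hGs : Complex.Gamma s ≠ 0 := by
      intro h1
      rw [h1, zero_mul, eq_comm, div_eq_zero_iff] at h
      tauto
    rw [eq_div_iff h0] at h
    field_simp
    linear_combination h

lemma hankelIntegral_pi_of_re_lt_one {s : ℂ} (hs : s.re < 1) (a : ℝ) :
    hankelIntegral s a (-π) π = 2 * π * Complex.I * (Complex.Gamma s)⁻¹ := by
  have hs' : 0 < (1 - s).re := by simpa using hs
  have hint := integrable_cexp_neg_exp_add hs'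
  have hp : Integrable fun x : ℝ => hankelIntegrand s (x + (π : ℝ) * Complex.I) := by
    simp only [hankelIntegrand_add_pi]; exact hint.const_mul _
  have hm : Integrable fun x : ℝ => hankelIntegrand s (x + (-π : ℝ) * Complex.I) := by
    simp only [hankelIntegrand_sub_pi]; exact hint.const_mul _
  have h1 := integral_Iic_sub_integral_Iic_of_differentiable (differentiable_hankelIntegrand s)
    (hm.integrableOn (s := Set.Iic a)) hp.integrableOn
    (tendsto_segment_hankelIntegrand_atBot hs (-π) π)
  have h2 := intervalIntegral.integral_Iic_add_Ioi (b := a) hp.integrableOn hp.integrableOn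
  have h3 := intervalIntegral.integral_Iic_add_Ioi (b := a) hm.integrableOn hm.integrableOn
  simp only [hankelIntegrand_add_pi, MeasureTheory.integral_const_mul,
    integral_cexp_neg_exp_add hs'] at h2
  simp only [hankelIntegrand_sub_pi, MeasureTheory.integral_const_mul,
    integral_cexp_neg_exp_add hs'] at h3
  have h4 := sin_pi_mul_Gamma_one_sub hs
  have h5 : Complex.sin (π * s) = Complex.sin (π * (1 - s)) := by
    rw [mul_sub, mul_one, Complex.sin_pi_sub]
  have h6 : Complex.exp (π * Complex.I * (1 - s)) - Complex.exp (-(π * Complex.I * (1 - s))) =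
      2 * Complex.I * Complex.sin (π * s) := by
    rw [h5, Complex.sin]
    have e1 : -(π * (1 - s)) * Complex.I = -(π * Complex.I * (1 - s)) := by ring
    have e2 : (π * (1 - s)) * Complex.I = (π * Complex.I * (1 - s)) := by ring
    rw [e1, e2]
    linear_combination (Complex.exp (π * Complex.I * (1 - s)) -
      Complex.exp (-(π * Complex.I * (1 - s)))) * Complex.I_mul_I
  unfold hankelIntegral
  rw [← h1]
  simp only [hankelIntegrand_add_pi, hankelIntegrand_sub_pi,
    MeasureTheory.integral_const_mul] at h2 h3 ⊢
  linear_combination h2 - h3 + 2 * Complex.I * h4 + Complex.Gamma (1 - s) * h6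

lemma hankelIntegral_one_pi (a : ℝ) : hankelIntegral 1 a (-π) π = 2 * π * Complex.I := by
  have h := (Complex.differentiable_exp.diffContOnCl
    (s := Metric.ball (0 : ℂ) (Real.exp a))).circleIntegral_sub_inv_smul
    (Metric.mem_ball_self (Real.exp_pos a))
  rw [circleIntegral] at h
  have hint (y : ℝ) : deriv (circleMap 0 (Real.exp a)) y • ((circleMap 0 (Real.exp a) y - 0)⁻¹ •
      Complex.exp (circleMap 0 (Real.exp a) y)) =
      Complex.I * hankelIntegrand 1 (a + y * Complex.I) := by
    have hne : circleMap 0 (Real.exp a) y ≠ 0 := by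
      simp [circleMap]
    simp only [deriv_circleMap, sub_zero, smul_eq_mul]
    rw [hankelIntegrand, sub_self, zero_mul, add_zero, Complex.exp_add, ← Complex.ofReal_exp]
    rw [show Complex.exp (circleMap 0 (Real.exp a) y) =
      Complex.exp ((Real.exp a : ℂ) * Complex.exp (y * Complex.I)) by simp [circleMap]]
    field_simp
  have hper : Function.Periodic (fun y : ℝ => hankelIntegrand 1 (a + y * Complex.I)) (2 * π) := by
    intro y
    have : (a : ℂ) + ((y + 2 * π : ℝ) : ℂ) * Complex.I =
      a + y * Complex.I + 2 * π * Complex.I := by push_cast; ring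
    simp only [hankelIntegrand, this, Complex.exp_periodic _, sub_self, zero_mul]
  have h1 := hper.intervalIntegral_add_eq 0 (-π)
  rw [zero_add, show -π + 2 * π = π by ring] at h1
  simp only [hint, intervalIntegral.integral_const_mul] at h
  rw [h1, Complex.exp_zero, smul_eq_mul, mul_one] at h
  unfold hankelIntegral
  simp only [hankelIntegrand_add_pi, hankelIntegrand_sub_pi]
  rw [h]
  simp

lemma hasDerivAt_cexp_exp_sub (s u : ℂ) :
    HasDerivAt (fun u => Complex.exp (Complex.exp u - s * u))
      (hankelIntegrand s u - s * hankelIntegrand (s + 1) u) u := by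
  have h : HasDerivAt (fun u => Complex.exp (Complex.exp u - s * u))
      (Complex.exp (Complex.exp u - s * u) * (Complex.exp u - s * 1)) u :=
    ((Complex.hasDerivAt_exp u).sub ((hasDerivAt_id u).const_mul s)).cexp
  refine h.congr_deriv ?_
  simp only [hankelIntegrand, mul_one]
  rw [show Complex.exp u + (1 - s) * u = (Complex.exp u - s * u) + u by ring, Complex.exp_add,
    show Complex.exp u + (1 - (s + 1)) * u = (Complex.exp u - s * u) by ring]
  ring

lemma integral_Ioi_hankelIntegrand_succ (s : ℂ) (a : ℝ) {y : ℝ} (hy : Real.cos y < 0) :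
    (∫ x in Set.Ioi a, hankelIntegrand s (x + y * Complex.I)) -
      s * (∫ x in Set.Ioi a, hankelIntegrand (s + 1) (x + y * Complex.I)) =
      -Complex.exp (Complex.exp (a + y * Complex.I) - s * (a + y * Complex.I)) := by
  have hd (x : ℝ) : HasDerivAt
      (fun x : ℝ => Complex.exp (Complex.exp (x + y * Complex.I) - s * (x + y * Complex.I)))
      (hankelIntegrand s (x + y * Complex.I) - s * hankelIntegrand (s + 1) (x + y * Complex.I))
      x := by
    have := (hasDerivAt_cexp_exp_sub s (x + y * Complex.I)).comp x
      ((Complex.ofRealCLM.hasDerivAt (x := x)).add_const (y * Complex.I))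
    simpa [Function.comp_def] using this
  have h1 := integrableOn_hankelIntegrand s a hy
  have h2 := (integrableOn_hankelIntegrand (s + 1) a hy).const_mul s
  have ht : Filter.Tendsto (fun x : ℝ =>
      Complex.exp (Complex.exp (x + y * Complex.I) - s * (x + y * Complex.I)))
      Filter.atTop (nhds 0) := by
    have h0 := (Real.tendsto_exp_neg_atTop_nhds_zero.comp
      (tendsto_mul_exp_sub_mul_atTop (neg_pos.2 hy) (1 - (s + 1).re))).const_mul
      (Real.exp (|(s + 1).im| * |y|))
    rw [mul_zero] at h0
    refine squeeze_zero_norm (fun x => ?_) h0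
    rw [show Complex.exp (x + y * Complex.I) - s * (x + y * Complex.I) =
      Complex.exp (x + y * Complex.I) + (1 - (s + 1)) * (x + y * Complex.I) by ring]
    exact norm_hankelIntegrand_le (s := s + 1) (neg_neg (Real.cos y)).ge le_rfl
  have h := integral_Ioi_of_hasDerivAt_of_tendsto (hd a).continuousAt.continuousWithinAt
    (fun x _ => hd x) (h1.sub h2) ht
  rw [MeasureTheory.integral_sub h1 h2, MeasureTheory.integral_const_mul, zero_sub] at h
  exact h

lemma integral_segment_hankelIntegrand_succ (s : ℂ) (a α β : ℝ) :
    Complex.I * (∫ y in α..β, hankelIntegrand s (a + y * Complex.I)) -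
      s * (Complex.I * ∫ y in α..β, hankelIntegrand (s + 1) (a + y * Complex.I)) =
      Complex.exp (Complex.exp (a + β * Complex.I) - s * (a + β * Complex.I)) -
      Complex.exp (Complex.exp (a + α * Complex.I) - s * (a + α * Complex.I)) := by
  have hd (y : ℝ) : HasDerivAt
      (fun y : ℝ => Complex.exp (Complex.exp (a + y * Complex.I) - s * (a + y * Complex.I)))
      (Complex.I * hankelIntegrand s (a + y * Complex.I) -
        s * Complex.I * hankelIntegrand (s + 1) (a + y * Complex.I)) y := by
    have := (hasDerivAt_cexp_exp_sub s (a + y * Complex.I)).comp y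
      (((Complex.ofRealCLM.hasDerivAt (x := y)).mul_const Complex.I).const_add (a : ℂ))
    refine this.congr_deriv ?_
    simp only [Complex.ofRealCLM_apply, Complex.ofReal_one]
    ring
  have h1 := (intervalIntegrable_hankelIntegrand s a α β).const_mul Complex.I
  have h2 := (intervalIntegrable_hankelIntegrand (s + 1) a α β).const_mul (s * Complex.I)
  have h := intervalIntegral.integral_eq_sub_of_hasDerivAt (fun y _ => hd y) (h1.sub h2)
  rw [intervalIntegral.integral_sub h1 h2, intervalIntegral.integral_const_mul,
    intervalIntegral.integral_const_mul] at h
  rw [← h]; ring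

lemma hankelIntegral_pi_succ (s : ℂ) (a : ℝ) :
    hankelIntegral s a (-π) π = s * hankelIntegral (s + 1) a (-π) π := by
  have h1 := integral_Ioi_hankelIntegrand_succ s a (y := π) (by simp)
  have h2 := integral_Ioi_hankelIntegrand_succ s a (y := -π) (by simp)
  have h3 := integral_segment_hankelIntegrand_succ s a (-π) π
  unfold hankelIntegral
  linear_combination h1 - h2 + h3

lemma hankelIntegral_pi (s : ℂ) (a : ℝ) :
    hankelIntegral s a (-π) π = 2 * π * Complex.I * (Complex.Gamma s)⁻¹ := by
  obtain ⟨n, hn⟩ := exists_nat_gt (s.re - 1)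
  have hn' : s.re < n + 1 := by linarith
  clear hn
  induction n generalizing s with
  | zero => exact hankelIntegral_pi_of_re_lt_one (by simpa using hn') a
  | succ n ih =>
    by_cases hs : s - 1 = 0
    · obtain rfl : s = 1 := by linear_combination hs
      simpa using hankelIntegral_one_pi a
    · have h1 := hankelIntegral_pi_succ (s - 1) a
      have h2 := Complex.Gamma_add_one _ hs
      rw [sub_add_cancel] at h1 h2
      rw [ih (s - 1) (by push_cast at hn'; simp; linarith)] at h1
      refine mul_left_cancel₀ hs (h1.symm.trans ?_)
      rw [h2, mul_inv]
      field_simp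

/-- **Hankel's representation** of the reciprocal Gamma function, with both ends of the contour
in the half-plane of decay. -/
lemma hankelIntegral_eq (s : ℂ) (a : ℝ) {α β : ℝ} (hα : α ∈ Set.Ioo (-(3 * π / 2)) (-(π / 2)))
    (hβ : β ∈ Set.Ioo (π / 2) (3 * π / 2)) :
    hankelIntegral s a α β = 2 * π * Complex.I * (Complex.Gamma s)⁻¹ := by
  rw [← hankelIntegral_pi s a]
  have hcos {y : ℝ} (hy : y ∈ Set.Ioo (π / 2) (3 * π / 2)) : Real.cos y < 0 :=
    Real.cos_neg_of_pi_div_two_lt_of_lt hy.1 (by linarith [hy.2])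
  have hπ := Real.pi_pos
  refine hankelIntegral_eq_of_cos_neg s a (fun y hy => ?_) (fun y hy => ?_)
  · have hy' : y ∈ Set.Ioo (-(3 * π / 2)) (-(π / 2)) :=
      Set.ordConnected_Ioo.uIcc_subset hα ⟨by linarith, by linarith⟩ hy
    rw [← Real.cos_neg]
    exact hcos ⟨by linarith [hy'.2], by linarith [hy'.1]⟩
  · exact hcos (Set.ordConnected_Ioo.uIcc_subset hβ ⟨by linarith, by linarith⟩ hy)

lemma integrable_mul_inv_one_sub_and_hasSum_integral {α : Type*} {m : MeasurableSpace α}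
    {ν : Measure α} {g q : α → ℂ} {c : ℝ} (hc0 : 0 ≤ c) (hc : c < 1) (hg : Integrable g ν)
    (hq : AEStronglyMeasurable q ν) (hqc : ∀ᵐ x ∂ν, ‖q x‖ ≤ c) :
    Integrable (fun x => g x * (1 - q x)⁻¹) ν ∧
      HasSum (fun k : ℕ => ∫ x, g x * q x ^ k ∂ν) (∫ x, g x * (1 - q x)⁻¹ ∂ν) := by
  constructor
  · refine hg.mul_bdd (c := (1 - c)⁻¹) ?_ ?_
    · exact (hq.aemeasurable.const_sub 1).inv.aestronglyMeasurable
    · filter_upwards [hqc] with x hx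
      rw [norm_inv]
      have h1 : 1 - c ≤ ‖1 - q x‖ := by
        have := norm_sub_norm_le (1 : ℂ) (q x)
        rw [norm_one] at this
        linarith
      exact inv_anti₀ (by linarith) h1
  · refine hasSum_integral_of_dominated_convergence (fun k x => ‖g x‖ * c ^ k)
      (fun k => hg.aestronglyMeasurable.mul (hq.pow k)) (fun k => ?_) ?_ ?_ ?_
    · filter_upwards [hqc] with x hx
      rw [norm_mul, norm_pow]
      gcongr
    · exact .of_forall fun x => (summable_geometric_of_lt_one hc0 hc).mul_left _
    · simp only [tsum_mul_left]
      exact hg.norm.mul_const _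
    · filter_upwards [hqc] with x hx
      exact (hasSum_geometric_of_norm_lt_one (hx.trans_lt hc)).mul_left _

/-- The Hankel integrand at `u = ρ (log (R r) + i (θ + φ))`. -/
noncomputable def polarHankelIntegrand (ρ : ℝ) (s : ℂ) (R θ r φ : ℝ) : ℂ :=
  hankelIntegrand s ((ρ * Real.log (R * r) : ℝ) + (ρ * (θ + φ) : ℝ) * Complex.I)

lemma image_mul_log_Ioi {ρ R r₀ : ℝ} (hρ : 0 < ρ) (hR : 0 < R) (hr₀ : 0 < r₀) :
    (fun r => ρ * Real.log (R * r)) '' Set.Ioi r₀ = Set.Ioi (ρ * Real.log (R * r₀)) := by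
  ext x
  simp only [Set.mem_image, Set.mem_Ioi]
  constructor
  · rintro ⟨r, hr, rfl⟩
    gcongr
  · intro hx
    refine ⟨Real.exp (x / ρ) / R, ?_, ?_⟩
    · rw [lt_div_iff₀ hR, mul_comm, ← Real.log_lt_iff_lt_exp (by positivity), lt_div_iff₀ hρ]
      linarith
    · rw [mul_div_cancel₀ _ hR.ne', Real.log_exp]
      field_simp

lemma polarHankelIntegrand_ray (s : ℂ) {ρ R θ r₀ φ : ℝ} (hρ : 0 < ρ) (hR : 0 < R) (hr₀ : 0 < r₀)
    (hφ : Real.cos (ρ * (θ + φ)) < 0) :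
    IntegrableOn (fun r : ℝ => (ρ / r : ℂ) * polarHankelIntegrand ρ s R θ r φ) (Set.Ioi r₀) ∧
      ∫ x in Set.Ioi (ρ * Real.log (R * r₀)),
        hankelIntegrand s (x + (ρ * (θ + φ) : ℝ) * Complex.I) =
      ∫ r in Set.Ioi r₀, (ρ / r : ℂ) * polarHankelIntegrand ρ s R θ r φ := by
  have hpos {r : ℝ} (hr : r ∈ Set.Ioi r₀) : 0 < r := hr₀.trans hr
  have hd (r : ℝ) (hr : r ∈ Set.Ioi r₀) :
      HasDerivWithinAt (fun r => ρ * Real.log (R * r)) (ρ / r) (Set.Ioi r₀) r := by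
    have hr' := hpos hr
    have := (((hasDerivAt_id r).const_mul R).log (mul_pos hR hr').ne').const_mul ρ
    refine (this.congr_deriv ?_).hasDerivWithinAt
    simp only [id]
    field_simp
  have hinj : Set.InjOn (fun r => ρ * Real.log (R * r)) (Set.Ioi r₀) := by
    intro r hr r' hr' h
    have hr := hpos hr
    have hr' := hpos hr'
    have h1 := Real.log_injOn_pos (mul_pos hR hr) (mul_pos hR hr') (mul_left_cancel₀ hρ.ne' h)
    exact mul_left_cancel₀ hR.ne' h1
  have heq : Set.EqOn (fun r : ℝ => |ρ / r| • hankelIntegrand s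
      ((ρ * Real.log (R * r) : ℝ) + (ρ * (θ + φ) : ℝ) * Complex.I))
      (fun r : ℝ => (ρ / r : ℂ) * polarHankelIntegrand ρ s R θ r φ) (Set.Ioi r₀) := by
    intro r hr
    simp only [abs_of_pos (div_pos hρ (hpos hr)), Complex.real_smul, Complex.ofReal_div,
      polarHankelIntegrand]
  constructor
  · have := integrableOn_hankelIntegrand s (ρ * Real.log (R * r₀)) hφ
    rw [← image_mul_log_Ioi hρ hR hr₀, integrableOn_image_iff_integrableOn_abs_deriv_smul
      measurableSet_Ioi hd hinj] at this
    exact this.congr_fun heq measurableSet_Ioi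
  · rw [← image_mul_log_Ioi hρ hR hr₀,
      integral_image_eq_integral_abs_deriv_smul measurableSet_Ioi hd hinj]
    exact setIntegral_congr_fun measurableSet_Ioi heq

lemma integral_segment_polarHankelIntegrand (s : ℂ) {ρ : ℝ} (hρ : 0 < ρ) (R θ r φ₁ φ₂ : ℝ) :
    ∫ y in (ρ * (θ + φ₁))..(ρ * (θ + φ₂)),
        hankelIntegrand s ((ρ * Real.log (R * r) : ℝ) + y * Complex.I) =
      ∫ φ in φ₁..φ₂, (ρ : ℂ) * polarHankelIntegrand ρ s R θ r φ := by
  have h := intervalIntegral.integral_comp_mul_add (a := φ₁) (b := φ₂) (fun y : ℝ =>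
    hankelIntegrand s ((ρ * Real.log (R * r) : ℝ) + y * Complex.I)) hρ.ne' (ρ * θ)
  rw [intervalIntegral.integral_const_mul]
  simp only [polarHankelIntegrand]
  have e (φ : ℝ) : ρ * (θ + φ) = ρ * φ + ρ * θ := by ring
  simp only [e]
  rw [h, Complex.real_smul, ← mul_assoc, ← Complex.ofReal_mul, mul_inv_cancel₀ hρ.ne',
    Complex.ofReal_one, one_mul]

lemma pow_mul_polarHankelIntegrand {ρ R r : ℝ} (hρ : 0 < ρ) (hR : 0 < R) (hr : 0 < r)
    (μ : ℂ) (θ φ : ℝ) (k : ℕ) :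
    ((R : ℂ) * Complex.exp (Complex.I * θ)) ^ k *
        polarHankelIntegrand ρ (μ + (k : ℂ) / (ρ : ℂ)) R θ r φ =
      polarHankelIntegrand ρ μ R θ r φ * ((r * Complex.exp (Complex.I * φ))⁻¹) ^ k := by
  have hρ' : (ρ : ℂ) ≠ 0 := by exact_mod_cast hρ.ne'
  have hR' : (R : ℂ) ≠ 0 := by exact_mod_cast hR.ne'
  have hr' : (r : ℂ) ≠ 0 := by exact_mod_cast hr.ne'
  simp only [polarHankelIntegrand, hankelIntegrand]
  set u : ℂ := (ρ * Real.log (R * r) : ℝ) + (ρ * (θ + φ) : ℝ) * Complex.I with hu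
  have hlog : Complex.exp (Real.log (R * r) : ℝ) = R * r := by
    rw [← Complex.ofReal_exp, Real.exp_log (mul_pos hR hr), Complex.ofReal_mul]
  have h1 : Complex.exp (Complex.exp u + (1 - (μ + k / ρ)) * u) =
      Complex.exp (Complex.exp u + (1 - μ) * u) * (Complex.exp (u / ρ))⁻¹ ^ k := by
    rw [← Complex.exp_neg, ← Complex.exp_nat_mul, ← Complex.exp_add]
    congr 1; ring
  have h2 : Complex.exp (u / ρ) =
      R * r * (Complex.exp (Complex.I * θ) * Complex.exp (Complex.I * φ)) := by
    rw [← hlog, ← Complex.exp_add, ← Complex.exp_add, hu]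
    congr 1
    push_cast
    field_simp
  rw [h1, h2, mul_left_comm, ← mul_pow]
  congr 2
  have := Complex.exp_ne_zero (Complex.I * θ)
  have := Complex.exp_ne_zero (Complex.I * φ)
  field_simp

lemma cexp_mul_cos_mul_cexp_I_mul (μ : ℂ) (ρ L θ φ : ℝ) :
    Complex.exp (Complex.exp ((ρ : ℂ) * ((L : ℂ) + Complex.I * (θ : ℂ))) *
        Complex.cos ((ρ : ℂ) * (φ : ℂ))) *
      Complex.exp (Complex.I * (Complex.exp ((ρ : ℂ) * ((L : ℂ) + Complex.I * (θ : ℂ))) *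
        Complex.sin ((ρ : ℂ) * (φ : ℂ)) + (ρ : ℂ) * (1 - μ) * (φ : ℂ))) *
      Complex.exp ((ρ : ℂ) * (1 - μ) * ((L : ℂ) + Complex.I * (θ : ℂ))) =
    hankelIntegrand μ ((ρ * L : ℝ) + (ρ * (θ + φ) : ℝ) * Complex.I) := by
  have h : Complex.exp ((ρ * L : ℝ) + (ρ * (θ + φ) : ℝ) * Complex.I) =
      Complex.exp ((ρ : ℂ) * ((L : ℂ) + Complex.I * (θ : ℂ))) *
        (Complex.cos ((ρ : ℂ) * (φ : ℂ)) + Complex.sin ((ρ : ℂ) * (φ : ℂ)) * Complex.I) := by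
    rw [← Complex.exp_mul_I, ← Complex.exp_add]
    congr 1; push_cast; ring
  rw [hankelIntegrand, h, ← Complex.exp_add, ← Complex.exp_add]
  congr 1; push_cast; ring

lemma ofReal_sq_add_two_mul_cos (r φ : ℝ) :
    ((r ^ 2 + 2 * r * Real.cos φ + 1 : ℝ) : ℂ) =
      (r + Complex.exp (Complex.I * φ)) * (r + (Complex.exp (Complex.I * φ))⁻¹) := by
  have h1 : Complex.exp (Complex.I * φ) + (Complex.exp (Complex.I * φ))⁻¹ =
      2 * Complex.cos φ := by
    rw [Complex.two_cos, ← Complex.exp_neg, mul_comm, neg_mul]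
  have h2 := mul_inv_cancel₀ (Complex.exp_ne_zero (Complex.I * φ))
  push_cast
  linear_combination -(r : ℂ) * h1 - h2

lemma add_ne_zero_of_norm_eq_one {r : ℝ} (hr : 1 < r) {w : ℂ} (hw : ‖w‖ = 1) :
    (r : ℂ) + w ≠ 0 := by
  intro h
  have h1 : ‖(r : ℂ)‖ = ‖w‖ := by rw [eq_neg_of_add_eq_zero_left h, norm_neg]
  rw [Complex.norm_real, Real.norm_of_nonneg (by linarith), hw] at h1
  linarith

lemma norm_cexp_I_mul (φ : ℝ) : ‖Complex.exp (Complex.I * φ)‖ = 1 := by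
  rw [mul_comm, Complex.norm_exp_ofReal_mul_I]

lemma add_cexp_div_sq_add {r : ℝ} (hr : 1 < r) (φ : ℝ) :
    (r + Complex.exp (Complex.I * φ)) / ((r ^ 2 + 2 * r * Real.cos φ + 1 : ℝ) : ℂ) =
      (r : ℂ)⁻¹ * (1 - (r * Complex.exp (Complex.I * (φ - π : ℝ)))⁻¹)⁻¹ := by
  have h1 := add_ne_zero_of_norm_eq_one hr (norm_cexp_I_mul φ)
  have h2 := add_ne_zero_of_norm_eq_one hr (w := (Complex.exp (Complex.I * φ))⁻¹)
    (by rw [norm_inv, norm_cexp_I_mul, inv_one])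
  have hr' : (r : ℂ) ≠ 0 := by exact_mod_cast (by linarith : r ≠ 0)
  have he := Complex.exp_ne_zero (Complex.I * φ)
  have h3 : Complex.exp (Complex.I * (φ - π : ℝ)) = -Complex.exp (Complex.I * φ) := by
    rw [← Complex.exp_sub_pi_mul_I]
    congr 1; push_cast; ring
  rw [ofReal_sq_add_two_mul_cos, h3, ← mul_inv, div_mul_cancel_left₀ h1]
  congr 1
  field_simp
  ring

lemma PF_eq {r : ℝ} (hr : 1 < r) (ρ : ℝ) (μ : ℂ) (R θ φ : ℝ) :
    PF ρ μ R θ r φ = (2 * (π : ℂ))⁻¹ * (ρ * polarHankelIntegrand ρ μ R θ r φ *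
      (1 - (r * Complex.exp (Complex.I * φ))⁻¹)⁻¹) := by
  have h := add_cexp_div_sq_add hr (φ + π)
  have h3 : Complex.exp (Complex.I * (φ + π : ℝ)) = -Complex.exp (Complex.I * φ) := by
    rw [← Complex.exp_add_pi_mul_I]
    congr 1; push_cast; ring
  rw [Real.cos_add_pi, h3, add_sub_cancel_right, mul_neg, ← sub_eq_add_neg, ← sub_eq_add_neg] at h
  have hr' : (r : ℂ) ≠ 0 := by exact_mod_cast (by linarith : r ≠ 0)
  have h4 : (1 - (r * Complex.exp (Complex.I * φ))⁻¹)⁻¹ = r * ((r - Complex.exp (Complex.I * φ)) /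
      ((r ^ 2 - 2 * r * Real.cos φ + 1 : ℝ) : ℂ)) := by
    rw [h, mul_inv_cancel_left₀ hr']
  rw [h4, polarHankelIntegrand, ← cexp_mul_cos_mul_cexp_I_mul, PF, chiF]
  ring

lemma KF_eq {r : ℝ} (hr : 1 < r) (ρ : ℝ) (μ : ℂ) (R θ φ₁ φ₂ : ℝ) :
    KF ρ μ R θ r φ₁ φ₂ = (2 * (π : ℂ) * Complex.I)⁻¹ *
      (ρ / r * polarHankelIntegrand ρ μ R θ r (φ₂ - π) *
        (1 - (r * Complex.exp (Complex.I * (φ₂ - π : ℝ)))⁻¹)⁻¹ -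
      ρ / r * polarHankelIntegrand ρ μ R θ r (φ₁ - π) *
        (1 - (r * Complex.exp (Complex.I * (φ₁ - π : ℝ)))⁻¹)⁻¹) := by
  have hD (φ : ℝ) : ((r ^ 2 + 2 * r * Real.cos φ + 1 : ℝ) : ℂ) ≠ 0 := by
    rw [ofReal_sq_add_two_mul_cos]
    exact mul_ne_zero (add_ne_zero_of_norm_eq_one hr (norm_cexp_I_mul φ))
      (add_ne_zero_of_norm_eq_one hr (by rw [norm_inv, norm_cexp_I_mul, inv_one]))
  have hterm (φ : ℝ) : ρ / r * polarHankelIntegrand ρ μ R θ r (φ - π) *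
        (1 - (r * Complex.exp (Complex.I * (φ - π : ℝ)))⁻¹)⁻¹ =
      ρ * Complex.exp ((ρ : ℂ) * (1 - μ) * ((Real.log (R * r) : ℂ) + Complex.I * (θ : ℂ))) *
      Complex.exp (-(Complex.I * (ρ : ℂ) * (π : ℂ) * (1 - μ))) *
      (Complex.exp (Complex.exp ((ρ : ℂ) * ((Real.log (R * r) : ℂ) +
        Complex.I * ((θ - π : ℝ) : ℂ))) * Complex.cos ((ρ : ℂ) * (φ : ℂ))) *
      Complex.exp (Complex.I * etaF ρ μ R θ r φ) * ((r + Complex.exp (Complex.I * φ)) /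
        ((r ^ 2 + 2 * r * Real.cos φ + 1 : ℝ) : ℂ))) := by
    have e1 : θ + (φ - π) = θ - π + φ := by ring
    have e2 : Complex.exp ((ρ : ℂ) * (1 - μ) * ((Real.log (R * r) : ℂ) +
        Complex.I * ((θ - π : ℝ) : ℂ))) =
      Complex.exp ((ρ : ℂ) * (1 - μ) * ((Real.log (R * r) : ℂ) + Complex.I * (θ : ℂ))) *
      Complex.exp (-(Complex.I * (ρ : ℂ) * (π : ℂ) * (1 - μ))) := by
      rw [← Complex.exp_add]
      congr 1; push_cast; ring
    rw [add_cexp_div_sq_add hr, polarHankelIntegrand, e1, ← cexp_mul_cos_mul_cexp_I_mul, e2, etaF]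
    ring
  have h1 := hD φ₁
  have h2 := hD φ₂
  rw [hterm, hterm, KF, AF, AF]
  generalize ((r ^ 2 + 2 * r * Real.cos φ₁ + 1 : ℝ) : ℂ) = D₁ at h1 ⊢
  generalize ((r ^ 2 + 2 * r * Real.cos φ₂ + 1 : ℝ) : ℂ) = D₂ at h2 ⊢
  field_simp

lemma polarHankel_eq (s : ℂ) {ρ R θ r₀ φ₁ φ₂ : ℝ} (hρ : 0 < ρ) (hR : 0 < R) (hr₀ : 0 < r₀)
    (h₁ : ρ * (θ + φ₁) ∈ Set.Ioo (-(3 * π / 2)) (-(π / 2)))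
    (h₂ : ρ * (θ + φ₂) ∈ Set.Ioo (π / 2) (3 * π / 2)) :
    Complex.I * (∫ φ in φ₁..φ₂, (ρ : ℂ) * polarHankelIntegrand ρ s R θ r₀ φ) +
      ((∫ r in Set.Ioi r₀, (ρ / r : ℂ) * polarHankelIntegrand ρ s R θ r φ₂) -
        ∫ r in Set.Ioi r₀, (ρ / r : ℂ) * polarHankelIntegrand ρ s R θ r φ₁) =
      2 * π * Complex.I * (Complex.Gamma s)⁻¹ := by
  have hcos {y : ℝ} (hy : y ∈ Set.Ioo (π / 2) (3 * π / 2)) : Real.cos y < 0 :=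
    Real.cos_neg_of_pi_div_two_lt_of_lt hy.1 (by linarith [hy.2])
  have hc₁ : Real.cos (ρ * (θ + φ₁)) < 0 := by
    rw [← Real.cos_neg]
    exact hcos ⟨by linarith [h₁.2], by linarith [h₁.1]⟩
  rw [← hankelIntegral_eq s (ρ * Real.log (R * r₀)) h₁ h₂, hankelIntegral,
    (polarHankelIntegrand_ray s hρ hR hr₀ hc₁).2, (polarHankelIntegrand_ray s hρ hR hr₀ (hcos h₂)).2,
    integral_segment_polarHankelIntegrand s hρ]

lemma ML_eq_integral (μ : ℂ) {ρ R θ r₀ φ₁ φ₂ : ℝ} (hρ : 0 < ρ) (hR : 0 < R) (hr₀ : 1 < r₀)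
    (hφ : φ₁ ≤ φ₂) (h₁ : ρ * (θ + φ₁) ∈ Set.Ioo (-(3 * π / 2)) (-(π / 2)))
    (h₂ : ρ * (θ + φ₂) ∈ Set.Ioo (π / 2) (3 * π / 2)) :
    ML ρ μ ((R : ℂ) * Complex.exp (Complex.I * (θ : ℂ))) =
      (∫ r in Set.Ioi r₀, KF ρ μ R θ r (φ₁ + π) (φ₂ + π)) + ∫ φ in φ₁..φ₂, PF ρ μ R θ r₀ φ := by
  have hr₀' : 0 < r₀ := one_pos.trans hr₀
  have hc : r₀⁻¹ < 1 := inv_lt_one_of_one_lt₀ hr₀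
  have hc0 : 0 ≤ r₀⁻¹ := inv_nonneg.2 hr₀'.le
  have hcos {y : ℝ} (hy : y ∈ Set.Ioo (π / 2) (3 * π / 2)) : Real.cos y < 0 :=
    Real.cos_neg_of_pi_div_two_lt_of_lt hy.1 (by linarith [hy.2])
  have hc₁ : Real.cos (ρ * (θ + φ₁)) < 0 := by
    rw [← Real.cos_neg]
    exact hcos ⟨by linarith [h₁.2], by linarith [h₁.1]⟩
  have hnorm (r φ : ℝ) (hr : r₀ ≤ r) : ‖((r : ℂ) * Complex.exp (Complex.I * φ))⁻¹‖ ≤ r₀⁻¹ := by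
    rw [norm_inv, norm_mul, norm_cexp_I_mul, mul_one, Complex.norm_real,
      Real.norm_of_nonneg (hr₀'.le.trans hr)]
    exact inv_anti₀ hr₀' hr
  have hray (φ : ℝ) (hφ : Real.cos (ρ * (θ + φ)) < 0) :=
    integrable_mul_inv_one_sub_and_hasSum_integral
      (q := fun r : ℝ => ((r : ℂ) * Complex.exp (Complex.I * φ))⁻¹) hc0 hc
      (polarHankelIntegrand_ray μ hρ hR hr₀' hφ).1
      (Measurable.aestronglyMeasurable (by fun_prop))
      ((ae_restrict_iff' measurableSet_Ioi).2 (.of_forall fun r hr => hnorm r φ (le_of_lt hr)))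
  have hseg := (integrable_mul_inv_one_sub_and_hasSum_integral
      (ν := volume.restrict (Set.Ioc φ₁ φ₂))
      (g := fun φ : ℝ => (ρ : ℂ) * polarHankelIntegrand ρ μ R θ r₀ φ)
      (q := fun φ : ℝ => ((r₀ : ℂ) * Complex.exp (Complex.I * φ))⁻¹) hc0 hc
      (by
        have : Continuous fun φ : ℝ => (ρ : ℂ) * polarHankelIntegrand ρ μ R θ r₀ φ :=
          continuous_const.mul ((continuous_hankelIntegrand μ).comp (by fun_prop))
        exact this.integrableOn_Ioc)
      (Measurable.aestronglyMeasurable (by fun_prop))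
      (.of_forall fun φ => hnorm r₀ φ le_rfl)).2
  obtain ⟨hi₁, hs₁⟩ := hray φ₁ hc₁
  obtain ⟨hi₂, hs₂⟩ := hray φ₂ (hcos h₂)
  have hsum := ((hseg.mul_left Complex.I).add (hs₂.sub hs₁)).mul_left (2 * (π : ℂ) * Complex.I)⁻¹
  have hπI : 2 * (π : ℂ) * Complex.I ≠ 0 := by simp [Real.pi_ne_zero]
  rw [ML]
  refine (tsum_congr fun k => ?_).trans (hsum.tsum_eq.trans ?_)
  · have hz := fun (r φ : ℝ) (hr : 0 < r) => pow_mul_polarHankelIntegrand hρ hR hr μ θ φ k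
    have hray_k (φ : ℝ) : ∫ r in Set.Ioi r₀, (ρ / r : ℂ) * polarHankelIntegrand ρ μ R θ r φ *
          ((r : ℂ) * Complex.exp (Complex.I * φ))⁻¹ ^ k =
        ((R : ℂ) * Complex.exp (Complex.I * θ)) ^ k * ∫ r in Set.Ioi r₀,
          (ρ / r : ℂ) * polarHankelIntegrand ρ (μ + (k : ℂ) / (ρ : ℂ)) R θ r φ := by
      rw [← MeasureTheory.integral_const_mul]
      refine setIntegral_congr_fun measurableSet_Ioi fun r hr => ?_
      rw [mul_assoc, ← hz r φ (hr₀'.trans hr)]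
      ring
    have hseg_k : ∫ φ in Set.Ioc φ₁ φ₂, (ρ : ℂ) * polarHankelIntegrand ρ μ R θ r₀ φ *
          ((r₀ : ℂ) * Complex.exp (Complex.I * φ))⁻¹ ^ k =
        ((R : ℂ) * Complex.exp (Complex.I * θ)) ^ k * ∫ φ in φ₁..φ₂,
          (ρ : ℂ) * polarHankelIntegrand ρ (μ + (k : ℂ) / (ρ : ℂ)) R θ r₀ φ := by
      rw [intervalIntegral.integral_of_le hφ, ← MeasureTheory.integral_const_mul]
      refine setIntegral_congr_fun measurableSet_Ioc fun φ _ => ?_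
      rw [mul_assoc, ← hz r₀ φ hr₀']
      ring
    have h := polarHankel_eq (μ + (k : ℂ) / (ρ : ℂ)) hρ hR hr₀' h₁ h₂
    rw [hray_k, hray_k, hseg_k, eq_inv_mul_iff_mul_eq₀ hπI]
    linear_combination -((R : ℂ) * Complex.exp (Complex.I * θ)) ^ k * h
  · have hK : ∫ r in Set.Ioi r₀, KF ρ μ R θ r (φ₁ + π) (φ₂ + π) = _ :=
      setIntegral_congr_fun measurableSet_Ioi fun r hr => KF_eq (hr₀.trans hr) ρ μ R θ _ _
    simp only [add_sub_cancel_right] at hK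
    rw [hK, MeasureTheory.integral_const_mul, MeasureTheory.integral_sub hi₂ hi₁,
      intervalIntegral.integral_of_le hφ]
    simp only [PF_eq hr₀]
    rw [MeasureTheory.integral_const_mul]
    have hI : (2 * (π : ℂ) * Complex.I)⁻¹ * Complex.I = (2 * (π : ℂ))⁻¹ := by
      rw [mul_inv, inv_mul_cancel_right₀ Complex.I_ne_zero]
    rw [mul_add, ← mul_assoc, hI]
    simp only [div_eq_mul_inv, mul_inv]
    ring

/-- Representation "A" (Theorem 2): `E_{ρ,μ}(z) = ∫_{1+ϵ}^∞ K dr + ∫_{-δ₁-π}^{δ₂-π} P dφ`. -/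
theorem mittagLeffler_repr_A
    (ρ ϵ δ₁ δ₂ R θ : ℝ) (μ : ℂ)
    (hρ : 1 / 2 < ρ) (hϵ : 0 < ϵ)
    (hδ₁l : π / (2 * ρ) < δ₁) (hδ₁u : δ₁ ≤ min π (π / ρ))
    (hδ₂l : π / (2 * ρ) < δ₂) (hδ₂u : δ₂ ≤ min π (π / ρ))
    (hR : 0 < R)
    (hθl : π / (2 * ρ) - δ₂ + π < θ) (hθu : θ < -(π / (2 * ρ)) + δ₁ + π) :
    ML ρ μ ((R : ℂ) * Complex.exp (Complex.I * (θ : ℂ))) =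
      (∫ r in Set.Ioi (1 + ϵ), KF ρ μ R θ r (-δ₁) δ₂) +
        ∫ φ in (-δ₁ - π)..(δ₂ - π), PF ρ μ R θ (1 + ϵ) φ := by
  have hρ0 : 0 < ρ := by linarith
  have hπ := Real.pi_pos
  have h1 : δ₁ ≤ π / ρ := hδ₁u.trans (min_le_right _ _)
  have h2 : δ₂ ≤ π / ρ := hδ₂u.trans (min_le_right _ _)
  have e1 : ρ * (π / (2 * ρ)) = π / 2 := by field_simp
  have e2 : ρ * (π / ρ) = π := by field_simp
  have h1' := mul_le_mul_of_nonneg_left h1 hρ0.le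
  have h2' := mul_le_mul_of_nonneg_left h2 hρ0.le
  have h3' := mul_lt_mul_of_pos_left hθl hρ0
  have h4' := mul_lt_mul_of_pos_left hθu hρ0
  have h5 : 0 < π / (2 * ρ) := by positivity
  have h := ML_eq_integral μ (θ := θ) (r₀ := 1 + ϵ) (φ₁ := -δ₁ - π) (φ₂ := δ₂ - π) hρ0 hR
    (by linarith) (by linarith) ⟨by nlinarith, by nlinarith⟩ ⟨by nlinarith, by nlinarith⟩
  rwa [sub_add_cancel, sub_add_cancel] at h
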